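/- There exists a constant C > 0 such that the following holds. For all n, d, for every injective tuple v_1, …, v_n ∈ 𝔽₂^d with V = {v_1, …, v_n}, for all finite sets N_1, …, N_n ⊆ V satisfying condition (i) (for all i, v_i + N_i = N_i) and condition (ii) (for all i and all j < i, v_j ∉ span_{𝔽₂}(N_i + N_i)), and for every 𝔽₂-linear subspace H ≤ 𝔽₂^d, one has Σ_{i : v_i ∈ H} |N_i \ (H ∪ (v_i + H))| ≤ C · n · |H|^{(log₂ 3)/2}. -/

import Mathlib

open Pointwise
open scoped Classical

open Module

section Monomials

variable {E : Type*} [AddCommGroup E] [Module (ZMod 2) E] {κ : Type*} [Fintype κ]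

/-- The square-free monomial functions of degree at most `s` in the coordinates of `b` span the
space of polynomial functions of degree at most `s`. -/
def polyFun (b : Basis κ (ZMod 2) E) (s : ℕ) : Submodule (ZMod 2) (E → ZMod 2) :=
  Submodule.span (ZMod 2)
    (((Finset.univ.filter fun A : Finset κ => A.card ≤ s).image
      fun A x => ∏ a ∈ A, b.repr x a : Finset (E → ZMod 2)) : Set (E → ZMod 2))

theorem monomial_mem_polyFun (b : Basis κ (ZMod 2) E) {s : ℕ} {A : Finset κ} (hA : A.card ≤ s) :
    (fun x => ∏ a ∈ A, b.repr x a) ∈ polyFun b s :=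
  Submodule.subset_span (by
    rw [Finset.mem_coe, Finset.mem_image]
    exact ⟨A, by simpa using hA, rfl⟩)

theorem polyFun_mono (b : Basis κ (ZMod 2) E) : Monotone (polyFun b) := by
  intro s t hst
  refine Submodule.span_mono ?_
  rw [Finset.coe_subset]
  refine Finset.image_subset_image fun A hA => ?_
  simp only [Finset.mem_filter, Finset.mem_univ, true_and] at hA ⊢
  exact hA.trans hst

theorem finrank_polyFun_le (b : Basis κ (ZMod 2) E) (s : ℕ) :
    finrank (ZMod 2) (polyFun b s) ≤ (Finset.univ.filter fun A : Finset κ => A.card ≤ s).card :=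
  (finrank_span_finset_le_card _).trans Finset.card_image_le

theorem mul_coord_mem_polyFun (b : Basis κ (ZMod 2) E) {s : ℕ} {f : E → ZMod 2}
    (hf : f ∈ polyFun b s) (a : κ) : (fun x => f x * b.repr x a) ∈ polyFun b (s + 1) := by
  induction hf using Submodule.span_induction with
  | mem f hf =>
    rw [Finset.mem_coe, Finset.mem_image] at hf
    obtain ⟨A, hA, rfl⟩ := hf
    have hA : A.card ≤ s := by simpa using hA
    by_cases ha : a ∈ A
    · convert monomial_mem_polyFun b (hA.trans s.le_succ) using 2 with x
      have idem : ∀ y : ZMod 2, y * y = y := by decide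
      simp only [← Finset.mul_prod_erase A _ ha]
      rw [mul_right_comm, idem]
    · convert monomial_mem_polyFun b (A := insert a A) (s := s + 1)
        ((Finset.card_insert_le _ _).trans (by omega)) using 2 with x
      rw [Finset.prod_insert ha, mul_comm]
  | zero =>
    convert (polyFun b (s + 1)).zero_mem using 2 with x
    simp
  | add f g _ _ hf hg =>
    convert (polyFun b (s + 1)).add_mem hf hg using 2 with x
    simp [add_mul]
  | smul c f _ hf =>
    convert (polyFun b (s + 1)).smul_mem c hf using 2 with x
    simp [mul_assoc]

theorem mul_one_add_linear_mem_polyFun (b : Basis κ (ZMod 2) E) {s : ℕ} {f : E → ZMod 2}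
    (hf : f ∈ polyFun b s) (L : E →ₗ[ZMod 2] ZMod 2) :
    (fun x => f x * (1 + L x)) ∈ polyFun b (s + 1) := by
  have key : (fun x => f x * (1 + L x)) =
      f + ∑ a, L (b a) • (fun x => f x * b.repr x a) := by
    ext x
    have hL : L x = ∑ a, b.repr x a * L (b a) := by
      conv_lhs => rw [← b.sum_repr x]
      simp only [map_sum, map_smul, smul_eq_mul]
    simp only [Pi.add_apply, Finset.sum_apply, Pi.smul_apply, smul_eq_mul, hL, mul_add, mul_one,
      Finset.mul_sum]
    congr 1
    exact Finset.sum_congr rfl fun a _ => by ring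
  rw [key]
  exact add_mem (polyFun_mono b s.le_succ hf)
    (sum_mem fun a _ => Submodule.smul_mem _ _ (mul_coord_mem_polyFun b hf a))

theorem prod_one_add_linear_mem_polyFun (b : Basis κ (ZMod 2) E) {σ : Type*} (S : Finset σ)
    (L : σ → E →ₗ[ZMod 2] ZMod 2) : (fun x => ∏ r ∈ S, (1 + L r x)) ∈ polyFun b S.card := by
  induction S using Finset.induction_on with
  | empty => simpa using monomial_mem_polyFun b (A := ∅) (s := 0) (by simp)
  | insert r S hr ih =>
    rw [Finset.card_insert_of_notMem hr]
    convert mul_one_add_linear_mem_polyFun b ih (L r) using 2 with x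
    rw [Finset.prod_insert hr, mul_comm]

/-- The indicator function of a subspace is polynomial of degree at most its codimension. -/
theorem indicator_mem_polyFun [FiniteDimensional (ZMod 2) E] (b : Basis κ (ZMod 2) E)
    (W : Submodule (ZMod 2) E) :
    (fun x => if x ∈ W then 1 else 0) ∈ polyFun b (finrank (ZMod 2) (E ⧸ W)) := by
  let B := finBasis (ZMod 2) (E ⧸ W)
  have h := prod_one_add_linear_mem_polyFun b Finset.univ fun r => B.coord r ∘ₗ W.mkQ
  rw [Finset.card_univ, Fintype.card_fin] at h
  convert h using 2 with x
  have one_add : ∀ y : ZMod 2, y ≠ 0 → 1 + y = 0 := by decide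
  split_ifs with hx
  · have : W.mkQ x = 0 := by simpa using hx
    simp [this]
  · have : W.mkQ x ≠ 0 := by simpa using hx
    obtain ⟨r, hr⟩ : ∃ r, B.coord r (W.mkQ x) ≠ 0 := by
      by_contra! hall
      exact this ((B.forall_coord_eq_zero_iff).1 hall)
    exact (Finset.prod_eq_zero (Finset.mem_univ r) (one_add _ hr)).symm

end Monomials

theorem linearIndependent_of_triangular_eval {K ι X : Type*} [Field K] [LinearOrder ι] [Fintype ι]
    (f : ι → X → K) (x : ι → X) (hdiag : ∀ i, f i (x i) ≠ 0)
    (hlow : ∀ i j, j < i → f i (x j) = 0) : LinearIndependent K f := by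
  rw [Fintype.linearIndependent_iff]
  intro c hc j
  induction j using WellFoundedLT.induction with
  | ind j ih =>
    have h := congrFun hc (x j)
    rw [Finset.sum_apply, Finset.sum_eq_single j] at h
    · simpa [hdiag j] using h
    · intro i _ hij
      rcases lt_or_gt_of_ne hij with hlt | hgt
      · simp [ih i hlt]
      · simp [hlow i j hgt]
    · simp

theorem two_pow_sub_eq_sum {k t : ℕ} (ht : t ≤ k) :
    2 ^ (k - t) = 1 + ∑ s ∈ Finset.range k, if t ≤ s then 2 ^ (k - 1 - s) else 0 := by
  induction k, ht using Nat.le_induction with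
  | base =>
    rw [Finset.sum_eq_zero]
    · simp
    · intro s hs
      rw [if_neg (by simpa using hs)]
  | succ k ht ih =>
    have hstep : ∀ s ∈ Finset.range k, (if t ≤ s then 2 ^ (k + 1 - 1 - s) else 0) =
        (if t ≤ s then 2 ^ (k - 1 - s) else 0) * 2 := by
      intro s hs
      have hs : s < k := by simpa using hs
      split_ifs
      · rw [← pow_succ]
        congr 1
        omega
      · simp
    rw [Finset.sum_range_succ, Finset.sum_congr rfl hstep, ← Finset.sum_mul, Nat.succ_sub ht,
      pow_succ, ih]
    simp [ht]
    ring

/-- If few indices lie at each level, the weighted sum of `2 ^ (k - t)` is controlled. -/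
theorem sum_two_pow_sub_le {ι κ : Type*} [Fintype ι] [Fintype κ] {k : ℕ} (t : ι → ℕ) (u : κ → ℕ)
    (ht : ∀ i, t i ≤ k) (hu : ∀ a, u a ≤ k)
    (h : ∀ s, (Finset.univ.filter fun i => t i ≤ s).card ≤
      (Finset.univ.filter fun a => u a ≤ s).card) :
    ∑ i, 2 ^ (k - t i) ≤ ∑ a, 2 ^ (k - u a) := by
  simp_rw [two_pow_sub_eq_sum (ht _), two_pow_sub_eq_sum (hu _), Finset.sum_add_distrib]
  rw [Finset.sum_comm, Finset.sum_comm (s := (Finset.univ : Finset κ))]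
  refine add_le_add ?_ (Finset.sum_le_sum fun s _ => ?_)
  · have h' := h k
    rw [Finset.filter_true_of_mem fun i _ => ht i,
      Finset.filter_true_of_mem fun a _ => hu a] at h'
    simpa using h'
  · rw [← Finset.sum_filter, ← Finset.sum_filter, Finset.sum_const, Finset.sum_const]
    exact Nat.mul_le_mul_right _ (h s)

/-- A skew Bollobás-type inequality for subspaces over `𝔽₂`. -/
theorem sum_card_le_three_pow {E ι : Type*} [AddCommGroup E] [Module (ZMod 2) E]
    [FiniteDimensional (ZMod 2) E] [Fintype ι] [LinearOrder ι] (x : ι → E)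
    (W : ι → Submodule (ZMod 2) E) (hmem : ∀ i, x i ∈ W i) (hnot : ∀ i j, j < i → x j ∉ W i) :
    ∑ i, Nat.card (W i) ≤ 3 ^ finrank (ZMod 2) E := by
  let b := finBasis (ZMod 2) E
  have hcard : ∀ i, Nat.card (W i) =
      2 ^ (finrank (ZMod 2) E - finrank (ZMod 2) (E ⧸ W i)) := by
    intro i
    rw [Module.natCard_eq_pow_finrank (K := ZMod 2), Nat.card_zmod,
      ← (W i).finrank_quotient_add_finrank, Nat.add_sub_cancel_left]
  calc ∑ i, Nat.card (W i)
      = ∑ i, 2 ^ (finrank (ZMod 2) E - finrank (ZMod 2) (E ⧸ W i)) :=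
        Finset.sum_congr rfl fun i _ => hcard i
    _ ≤ ∑ A : Finset (Fin (finrank (ZMod 2) E)), 2 ^ (finrank (ZMod 2) E - A.card) := by
        refine sum_two_pow_sub_le _ _ (fun i => (W i).finrank_quotient_le)
          (fun A => by simpa using A.card_le_univ) fun s => ?_
        refine le_trans ?_ (finrank_polyFun_le b s)
        let f : {i // finrank (ZMod 2) (E ⧸ W i) ≤ s} → polyFun b s := fun i =>
          ⟨_, polyFun_mono b i.2 (indicator_mem_polyFun b (W i.1))⟩
        have hf : LinearIndependent (ZMod 2) f := by
          refine LinearIndependent.of_comp (polyFun b s).subtype ?_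
          refine linearIndependent_of_triangular_eval _ (fun i => x i.1) (fun i => ?_)
            fun i j hij => ?_
          · simp [f, hmem]
          · simp [f, hnot i.1 j.1 hij]
        have : Module.Finite (ZMod 2) (polyFun b s) :=
          FiniteDimensional.span_finset _ _
        simpa [Fintype.card_subtype] using hf.fintype_card_le_finrank
    _ = 3 ^ finrank (ZMod 2) E := by
        have h := Fintype.sum_pow_mul_eq_add_pow (Fin (finrank (ZMod 2) E)) 1 (2 : ℕ)
        simpa using h

theorem le_mul_sqrt_of_le {a m t : ℝ} (ha : 0 ≤ a) (hm : 0 ≤ m) (h₁ : a ≤ m * m) (h₂ : a ≤ t) :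
    a ≤ m * √t := by
  have ht : 0 ≤ t := ha.trans h₂
  refine (sq_le_sq₀ ha (by positivity)).1 ?_
  rw [mul_pow, Real.sq_sqrt ht, sq, sq]
  exact mul_le_mul h₁ h₂ ha (by positivity)

/-- The indices `i` with `v i ∈ H`, weighted by the size of the part of `N i` in a fixed coset
of `H`, are controlled by the number of vectors `v i` in that coset and by the size of `H`. -/
theorem sum_card_filter_mkQ_le {E ι : Type*} [AddCommGroup E] [Module (ZMod 2) E]
    [Finite E] [DecidableEq E] [Fintype ι] [LinearOrder ι] {v : ι → E} (hv : Function.Injective v)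
    {N : ι → Finset E} (hNV : ∀ i, N i ⊆ Finset.univ.image v)
    (hN : ∀ i, ∀ w ∈ N i, v i + w ∈ N i)
    (hspan : ∀ i j, j < i → v j ∉ Submodule.span (ZMod 2) ((N i + N i : Finset E) : Set E))
    (H : Submodule (ZMod 2) E) (c : E ⧸ H) :
    ((∑ i with v i ∈ H, ((N i).filter fun w => H.mkQ w = c).card : ℕ) : ℝ) ≤
      ((Finset.univ.image v).filter fun w => H.mkQ w = c).card *
        (Nat.card H : ℝ) ^ (Real.logb 2 3 / 2) := by
  have hsub : ∀ x y : E, x - y = x + y := fun x y => by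
    rw [sub_eq_add_neg, ← neg_one_smul (ZMod 2) y, show (-1 : ZMod 2) = 1 by decide, one_smul]
  set S := ∑ i with v i ∈ H, ((N i).filter fun w => H.mkQ w = c).card with hS
  set m := ((Finset.univ.image v).filter fun w => H.mkQ w = c).card with hm
  have hsq : S ≤ m * m := by
    rw [hS, hm, ← Finset.card_sigma, ← Finset.card_product]
    refine Finset.card_le_card_of_injOn (fun p => (p.2, v p.1 + p.2)) ?_ ?_
    · rintro ⟨i, w⟩ hp
      simp only [Finset.coe_sigma, Set.mem_sigma_iff, Finset.mem_coe, Finset.mem_filter,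
        Finset.mem_univ, true_and] at hp
      obtain ⟨hi, hw, hc⟩ := hp
      have hvi : H.mkQ (v i) = 0 := by simpa using hi
      simp only [Finset.coe_product, Set.mem_prod, Finset.mem_coe, Finset.mem_filter]
      exact ⟨⟨hNV i hw, hc⟩, hNV i (hN i w hw), by rw [map_add, hvi, hc, zero_add]⟩
    · rintro ⟨i, w⟩ - ⟨j, w'⟩ - h
      simp only [Prod.mk.injEq] at h
      obtain ⟨rfl, h⟩ := h
      obtain rfl := hv (add_right_cancel h)
      rfl
  have hthree : S ≤ 3 ^ finrank (ZMod 2) H := by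
    let W : ι → Submodule (ZMod 2) H := fun i =>
      (Submodule.span (ZMod 2) ((N i + N i : Finset E) : Set E)).comap H.subtype
    have hspan_add : ∀ i, ∀ x ∈ N i, ∀ y ∈ N i,
        x + y ∈ Submodule.span (ZMod 2) ((N i + N i : Finset E) : Set E) := fun i x hx y hy =>
      Submodule.subset_span (Finset.mem_coe.2 (Finset.add_mem_add hx hy))
    have hcoset : ∀ i, ((N i).filter fun w => H.mkQ w = c).card ≤ Nat.card (W i) := by
      intro i
      rcases ((N i).filter fun w => H.mkQ w = c).eq_empty_or_nonempty with h0 | ⟨w₀, hw₀⟩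
      · rw [h0, Finset.card_empty]
        exact Nat.zero_le _
      rw [Finset.mem_filter] at hw₀
      have hmemH : ∀ w, H.mkQ w = c → w + w₀ ∈ H := fun w hw => by
        rw [← hsub, ← Submodule.Quotient.eq]
        exact hw.trans hw₀.2.symm
      rw [← Nat.card_eq_finsetCard]
      refine Nat.card_le_card_of_injective
        (fun w => ⟨⟨w.1 + w₀, hmemH w.1 (Finset.mem_filter.1 w.2).2⟩,
          hspan_add i _ (Finset.mem_filter.1 w.2).1 _ hw₀.1⟩) fun w w' h => ?_
      simpa [Subtype.ext_iff] using h
    let J := {i // v i ∈ H ∧ (N i).Nonempty}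
    calc S = ∑ i with v i ∈ H ∧ (N i).Nonempty, ((N i).filter fun w => H.mkQ w = c).card := by
          rw [hS, ← Finset.filter_filter]
          refine (Finset.sum_filter_of_ne ?_).symm
          intro i _ hi
          obtain ⟨w, hw⟩ := Finset.card_ne_zero.1 hi
          exact ⟨w, (Finset.mem_filter.1 hw).1⟩
      _ ≤ ∑ i with v i ∈ H ∧ (N i).Nonempty, Nat.card (W i) :=
          Finset.sum_le_sum fun i _ => hcoset i
      _ = ∑ i : J, Nat.card (W i.1) := Finset.sum_subtype _ (by simp) _
      _ ≤ 3 ^ finrank (ZMod 2) H := by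
          refine sum_card_le_three_pow (fun i : J => (⟨v i.1, i.2.1⟩ : H)) (fun i => W i.1) ?_ ?_
          · rintro ⟨i, hi, w, hw⟩
            have h := hspan_add i _ (hN i w hw) w hw
            rw [← hsub, add_sub_cancel_right] at h
            exact h
          · intro i j hij
            exact hspan i.1 j.1 hij
  have hH : (Nat.card H : ℝ) ^ (Real.logb 2 3 / 2) = √(3 ^ finrank (ZMod 2) H) := by
    rw [Module.natCard_eq_pow_finrank (K := ZMod 2) (V := H), Nat.card_zmod, Nat.cast_pow,
      Nat.cast_ofNat, ← Real.rpow_natCast, ← Real.rpow_natCast, Real.sqrt_eq_rpow,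
      ← Real.rpow_mul (by norm_num), ← Real.rpow_mul (by norm_num), mul_one_div,
      ← mul_div_assoc, mul_comm (finrank (ZMod 2) H : ℝ), mul_div_assoc,
      Real.rpow_mul (by norm_num), Real.rpow_logb] <;> norm_num
  rw [hH]
  exact le_mul_sqrt_of_le (Nat.cast_nonneg _) (Nat.cast_nonneg _) (by exact_mod_cast hsq)
    (by exact_mod_cast hthree)

/-- Lemma (b) on middle sums. There is `C > 0` such that for all systems
`(v, N)` satisfying conditions (i), (ii) and for every subspace `H ≤ 𝔽₂^d`,
`∑_{i : v i ∈ H} |N i \ (H ∪ (v i + H))| ≤ C * n * |H| ^ ((log₂ 3)/2)`.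
(In characteristic 2, `w ∈ v i + H ↔ w + v i ∈ H`.) -/
theorem statement11 :
    ∃ C : ℝ, 0 < C ∧
      ∀ (n d : ℕ) (v : Fin n → (Fin d → ZMod 2)),
        Function.Injective v →
        ∀ N : Fin n → Finset (Fin d → ZMod 2),
          (∀ i, N i ⊆ Finset.univ.image v) →
          (∀ i, (N i).image (fun w => v i + w) = N i) →
          (∀ i j : Fin n, j < i →
            v j ∉ Submodule.span (ZMod 2)
              (((N i + N i : Finset (Fin d → ZMod 2))) : Set (Fin d → ZMod 2))) →
          ∀ H : Submodule (ZMod 2) (Fin d → ZMod 2),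
            (∑ i ∈ Finset.univ.filter (fun i : Fin n => v i ∈ H),
              (((N i).filter (fun w => ¬ (w ∈ H ∨ w + v i ∈ H))).card : ℝ))
              ≤ C * n * (Nat.card H : ℝ) ^ (Real.logb 2 3 / 2) := by
  refine ⟨1, one_pos, fun n d v hv N hNV hN hspan H => ?_⟩
  have hN' : ∀ i, ∀ w ∈ N i, v i + w ∈ N i := fun i w hw =>
    (hN i).subset (Finset.mem_image_of_mem _ hw)
  let T := (Finset.univ.image v).image H.mkQ
  have hfiber : ∀ s : Finset (Fin d → ZMod 2), s ⊆ Finset.univ.image v →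
      s.card = ∑ c ∈ T, (s.filter fun w => H.mkQ w = c).card := fun s hs =>
    Finset.card_eq_sum_card_fiberwise fun w hw => Finset.mem_image_of_mem _ (hs hw)
  calc (∑ i ∈ Finset.univ.filter (fun i : Fin n => v i ∈ H),
        (((N i).filter (fun w => ¬ (w ∈ H ∨ w + v i ∈ H))).card : ℝ))
      ≤ ∑ i with v i ∈ H, ((N i).card : ℝ) := by
        gcongr
        exact Finset.filter_subset _ _
    _ = ∑ c ∈ T, ((∑ i with v i ∈ H, ((N i).filter fun w => H.mkQ w = c).card : ℕ) : ℝ) := by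
        rw [← Nat.cast_sum, ← Nat.cast_sum, Finset.sum_comm]
        exact congrArg _ (Finset.sum_congr rfl fun i _ => hfiber _ (hNV i))
    _ ≤ ∑ c ∈ T, (((Finset.univ.image v).filter fun w => H.mkQ w = c).card *
          (Nat.card H : ℝ) ^ (Real.logb 2 3 / 2)) :=
        Finset.sum_le_sum fun c _ => sum_card_filter_mkQ_le hv hNV hN' hspan H c
    _ = 1 * n * (Nat.card H : ℝ) ^ (Real.logb 2 3 / 2) := by
        rw [← Finset.sum_mul, ← Nat.cast_sum, ← hfiber _ subset_rfl,
          Finset.card_image_of_injective _ hv, Finset.card_univ, Fintype.card_fin, one_mul]
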